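/- For every x ∈ H there exists a unique y ∈ H such that 0 ∈ x ⊞ y. Explicitly, the inverse of 0 is 0, the inverse of (+,a) is (−,a), the inverse of (−,a) is (+,a), and the inverse of (Λ,a) is (Λ,a) itself, for every a > 0. -/

import Mathlib

inductive Sgn : Type
  | pos | neg | lam
deriving DecidableEq

inductive H : Type
  | zero : H
  | elt (σ : Sgn) (a : ℝ) (ha : 0 < a) : H

noncomputable def hadd : H → H → Set H
  | H.zero, x => {x}
  | x, H.zero => {x}
  | H.elt Sgn.pos a _, H.elt Sgn.pos b _ =>
      {H.elt Sgn.pos (a + b) (by linarith)}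
  | H.elt Sgn.neg a _, H.elt Sgn.neg b _ =>
      {H.elt Sgn.neg (a + b) (by linarith)}
  | H.elt Sgn.pos a _, H.elt Sgn.neg b _ =>
      if h : b < a then {H.elt Sgn.pos (a - b) (by linarith)}
      else if h' : a = b then {H.zero}
      else {H.elt Sgn.neg (b - a)
        (by push_neg at h; exact sub_pos.mpr (lt_of_le_of_ne h h'))}
  | H.elt Sgn.neg b _, H.elt Sgn.pos a _ =>
      if h : b < a then {H.elt Sgn.pos (a - b) (by linarith)}
      else if h' : a = b then {H.zero}
      else {H.elt Sgn.neg (b - a)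
        (by push_neg at h; exact sub_pos.mpr (lt_of_le_of_ne h h'))}
  | H.elt Sgn.pos a _, H.elt Sgn.lam b _ => {H.elt Sgn.lam (a + b) (by linarith)}
  | H.elt Sgn.neg a _, H.elt Sgn.lam b _ => {H.elt Sgn.lam (a + b) (by linarith)}
  | H.elt Sgn.lam b _, H.elt Sgn.pos a _ => {H.elt Sgn.lam (a + b) (by linarith)}
  | H.elt Sgn.lam b _, H.elt Sgn.neg a _ => {H.elt Sgn.lam (a + b) (by linarith)}
  | H.elt Sgn.lam a _, H.elt Sgn.lam b _ =>
      if h : a = b then {H.elt Sgn.lam (2 * a) (by linarith), H.zero}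
      else {H.elt Sgn.lam (a + b) (by linarith),
            H.elt Sgn.pos |a - b| (abs_pos.mpr (sub_ne_zero.mpr h)),
            H.elt Sgn.neg |a - b| (abs_pos.mpr (sub_ne_zero.mpr h))}

/-- Left bracketing `(x ⊞ y) ⊞ z` of the triple hyper-sum. -/
noncomputable def haddL (x y z : H) : Set H := ⋃ u ∈ hadd x y, hadd u z

/-- Right bracketing `x ⊞ (y ⊞ z)` of the triple hyper-sum. -/
noncomputable def haddR (x y z : H) : Set H := ⋃ v ∈ hadd y z, hadd x v

/-- The inverse for the hyperaddition: it swaps `pos` and `neg` and fixes the rest. -/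
def hneg : H → H
  | H.zero => H.zero
  | H.elt Sgn.pos a ha => H.elt Sgn.neg a ha
  | H.elt Sgn.neg a ha => H.elt Sgn.pos a ha
  | H.elt Sgn.lam a ha => H.elt Sgn.lam a ha

theorem zero_mem_hadd_iff (x y : H) : H.zero ∈ hadd x y ↔ y = hneg x := by
  rcases x with _ | ⟨_ | _ | _, a, ha⟩ <;> rcases y with _ | ⟨_ | _ | _, b, hb⟩ <;>
    simp only [hadd, hneg] <;> (try split_ifs) <;> simp <;> grind

theorem stmt_4 :
    (∀ x : H, ∃! y : H, H.zero ∈ hadd x y) ∧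
    (H.zero ∈ hadd H.zero H.zero) ∧
    (∀ (a : ℝ) (ha : 0 < a), H.zero ∈ hadd (H.elt Sgn.pos a ha) (H.elt Sgn.neg a ha)) ∧
    (∀ (a : ℝ) (ha : 0 < a), H.zero ∈ hadd (H.elt Sgn.neg a ha) (H.elt Sgn.pos a ha)) ∧
    (∀ (a : ℝ) (ha : 0 < a), H.zero ∈ hadd (H.elt Sgn.lam a ha) (H.elt Sgn.lam a ha)) := by
  refine ⟨fun x => ⟨hneg x, (zero_mem_hadd_iff _ _).2 rfl, fun y => (zero_mem_hadd_iff x y).1⟩,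
    ?_, ?_, ?_, ?_⟩ <;> intros <;> exact (zero_mem_hadd_iff _ _).2 rfl
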